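/- The min-max regret is bounded above by the conditional capacity of the data-generating family: R*_N(Θ, Φ) ≤ C_{c,N}(Φ). -/

import Mathlib

noncomputable section

/-- A model: a strictly positive probability function on `Y^(n+1)`. -/
def IsModel {Y : Type*} [Fintype Y] {n : ℕ} (P : (Fin (n + 1) → Y) → ℝ) : Prop :=
  (∀ y, 0 < P y) ∧ (∑ y, P y) = 1

/-- A predictor: to every prefix `y^{N-1}` it assigns a strictly positive
probability function on `Y`. -/
def IsPredictor {Y : Type*} [Fintype Y] {n : ℕ} (Q : (Fin n → Y) → Y → ℝ) : Prop :=
  ∀ z, (∀ y, 0 < Q z y) ∧ (∑ y, Q z y) = 1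

/-- Marginal probability `P(y^{N-1}) = Σ_y P(y^{N-1}, y)` of a prefix. -/
def prefixProb {Y : Type*} [Fintype Y] {n : ℕ} (P : (Fin (n + 1) → Y) → ℝ)
    (z : Fin n → Y) : ℝ :=
  ∑ y : Y, P (Fin.snoc z y)

/-- Conditional probability `P(y_N | y^{N-1}) = P(y^N) / P(y^{N-1})`. -/
def condProb {Y : Type*} [Fintype Y] {n : ℕ} (P : (Fin (n + 1) → Y) → ℝ)
    (y : Fin (n + 1) → Y) : ℝ :=
  P y / prefixProb P (Fin.init y)

/-- The regret
`R_N(Pφ, Pθ, Q) = Σ_{y^N} Pφ(y^N) log( Pθ(y_N|y^{N-1}) / Q(y_N|y^{N-1}) )`. -/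
def regretN {Y : Type*} [Fintype Y] {n : ℕ} (Pφ Pθ : (Fin (n + 1) → Y) → ℝ)
    (Q : (Fin n → Y) → Y → ℝ) : ℝ :=
  ∑ y, Pφ y * Real.log (condProb Pθ y / Q (Fin.init y) (y (Fin.last n)))

/-- Conditional KL divergence of a model `P` from a predictor `Q`. -/
def DcPred {Y : Type*} [Fintype Y] {n : ℕ} (P : (Fin (n + 1) → Y) → ℝ)
    (Q : (Fin n → Y) → Y → ℝ) : ℝ :=
  ∑ y, P y * Real.log (condProb P y / Q (Fin.init y) (y (Fin.last n)))

/-- Conditional KL divergence of a model `P` from another model `P'`. -/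
def DcModel {Y : Type*} [Fintype Y] {n : ℕ} (P P' : (Fin (n + 1) → Y) → ℝ) : ℝ :=
  ∑ y, P y * Real.log (condProb P y / condProb P' y)

/-- A prior: a probability vector on the index set `F`. -/
def IsPrior {F : Type*} [Fintype F] (π : F → ℝ) : Prop :=
  (∀ φ, 0 ≤ π φ) ∧ (∑ φ, π φ) = 1

/-- Conditional divergence of a model from the hypothesis class
`Θ = {P θ : θ ∈ G}`: the minimum over `θ ∈ G` of `D_{c,N}(P ‖ P θ)`. -/
def DcSet {Y F : Type*} [Fintype Y] [Fintype F] {n : ℕ}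
    (P : F → (Fin (n + 1) → Y) → ℝ) (G : Finset F) (hG : G.Nonempty)
    (Pφ : (Fin (n + 1) → Y) → ℝ) : ℝ :=
  G.inf' hG fun θ => DcModel Pφ (P θ)

/-- The mixture predictor
`Q_π(y_N | y^{N-1}) = (Σ_φ π(φ) P_φ(y^N)) / (Σ_φ π(φ) P_φ(y^{N-1}))`. -/
def mixPred {Y F : Type*} [Fintype Y] [Fintype F] {n : ℕ}
    (P : F → (Fin (n + 1) → Y) → ℝ) (π : F → ℝ) : (Fin n → Y) → Y → ℝ :=
  fun z y => (∑ φ, π φ * P φ (Fin.snoc z y)) / (∑ φ, π φ * prefixProb (P φ) z)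

/-- `I_π(Y_N; Φ | Y^{N-1})`. -/
def mutualInfoN {Y F : Type*} [Fintype Y] [Fintype F] {n : ℕ}
    (P : F → (Fin (n + 1) → Y) → ℝ) (π : F → ℝ) : ℝ :=
  ∑ φ, ∑ y, π φ * P φ y *
    Real.log (condProb (P φ) y / mixPred P π (Fin.init y) (y (Fin.last n)))

/-- `J(π) = I_π(Y_N; Φ | Y^{N-1}) − Σ_φ π(φ) D_{c,N}(P_φ ‖ Θ)`. -/
def Jfun {Y F : Type*} [Fintype Y] [Fintype F] {n : ℕ}
    (P : F → (Fin (n + 1) → Y) → ℝ) (G : Finset F) (hG : G.Nonempty)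
    (π : F → ℝ) : ℝ :=
  mutualInfoN P π - ∑ φ, π φ * DcSet P G hG (P φ)

/-- The min-max regret
`R*_N(Θ, Φ) = inf_Q max_{φ ∈ F} max_{θ ∈ G} R_N(P_φ, P_θ, Q)`. -/
def Rstar {Y F : Type*} [Fintype Y] [Fintype F] [Nonempty F] {n : ℕ}
    (P : F → (Fin (n + 1) → Y) → ℝ) (G : Finset F) (hG : G.Nonempty) : ℝ :=
  sInf {r : ℝ | ∃ Q, IsPredictor Q ∧
    r = Finset.univ.sup' Finset.univ_nonempty fun φ =>
          G.sup' hG fun θ => regretN (P φ) (P θ) Q}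

/-- The conditional capacity `C_{c,N}(Φ) = sup_π I_π(Y_N; Φ | Y^{N-1})`. -/
def capacityN {Y F : Type*} [Fintype Y] [Fintype F] {n : ℕ}
    (P : F → (Fin (n + 1) → Y) → ℝ) : ℝ :=
  sSup {r : ℝ | ∃ π, IsPrior π ∧ r = mutualInfoN P π}

/-- The binary entropy `h(λ) = −λ log λ − (1−λ) log(1−λ)`
(with `h(0) = h(1) = 0`, using `Real.log 0 = 0`). -/
def binEnt (l : ℝ) : ℝ := -(l * Real.log l) - (1 - l) * Real.log (1 - l)

section Mixture

variable {Y F : Type*} [Fintype Y] [Fintype F] {n : ℕ}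

theorem sum_eq_sum_snoc (f : (Fin (n + 1) → Y) → ℝ) :
    ∑ y, f y = ∑ z : Fin n → Y, ∑ a : Y, f (Fin.snoc z a) := by
  rw [← (Fin.snocEquiv fun _ : Fin (n + 1) => Y).sum_comp, Fintype.sum_prod_type_right]
  rfl

theorem prefixProb_pos [Nonempty Y] {P : (Fin (n + 1) → Y) → ℝ} (hP : ∀ y, 0 < P y)
    (z : Fin n → Y) : 0 < prefixProb P z :=
  Finset.sum_pos (fun _ _ => hP _) Finset.univ_nonempty

theorem condProb_pos [Nonempty Y] {P : (Fin (n + 1) → Y) → ℝ} (hP : ∀ y, 0 < P y)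
    (y : Fin (n + 1) → Y) : 0 < condProb P y :=
  div_pos (hP y) (prefixProb_pos hP _)

theorem DcPred_nonneg [Nonempty Y] {P : (Fin (n + 1) → Y) → ℝ} (hP : ∀ y, 0 < P y)
    {Q : (Fin n → Y) → Y → ℝ} (hQ : IsPredictor Q) : 0 ≤ DcPred P Q := by
  have hsum : ∑ y, (P y - prefixProb P (Fin.init y) * Q (Fin.init y) (y (Fin.last n))) = 0 := by
    rw [sum_eq_sum_snoc]
    refine Finset.sum_eq_zero fun z _ => ?_
    simp only [Fin.init_snoc, Fin.snoc_last, Finset.sum_sub_distrib, ← Finset.mul_sum, (hQ z).2]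
    simp [prefixProb]
  rw [← hsum]
  refine Finset.sum_le_sum fun y _ => ?_
  have hq := (hQ (Fin.init y)).1 (y (Fin.last n))
  have hc := condProb_pos hP y
  have hz := prefixProb_pos hP (Fin.init y)
  have hlog := Real.one_sub_inv_le_log_of_pos (div_pos hc hq)
  refine le_trans (le_of_eq ?_) (mul_le_mul_of_nonneg_left hlog (hP y).le)
  have := (hP y).ne'
  unfold condProb
  field_simp

/-- The regret is the divergence from the predictor minus the divergence from the
reference model. -/
theorem regretN_eq_sub [Nonempty Y] {Pφ Pθ : (Fin (n + 1) → Y) → ℝ}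
    (hφ : ∀ y, 0 < Pφ y) (hθ : ∀ y, 0 < Pθ y)
    {Q : (Fin n → Y) → Y → ℝ} (hQ : IsPredictor Q) :
    regretN Pφ Pθ Q = DcPred Pφ Q - DcModel Pφ Pθ := by
  simp only [regretN, DcPred, DcModel, ← Finset.sum_sub_distrib]
  refine Finset.sum_congr rfl fun y _ => ?_
  have hq := (hQ (Fin.init y)).1 (y (Fin.last n))
  rw [Real.log_div (condProb_pos hθ y).ne' hq.ne', Real.log_div (condProb_pos hφ y).ne' hq.ne',
    Real.log_div (condProb_pos hφ y).ne' (condProb_pos hθ y).ne']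
  ring

theorem isPredictor_condProb [Nonempty Y] {P : (Fin (n + 1) → Y) → ℝ} (hP : ∀ y, 0 < P y) :
    IsPredictor fun z a => condProb P (Fin.snoc z a) := by
  refine fun z => ⟨fun a => condProb_pos hP _, ?_⟩
  simp only [condProb, Fin.init_snoc, ← Finset.sum_div]
  exact div_self (prefixProb_pos hP z).ne'

theorem DcModel_nonneg [Nonempty Y] {P P' : (Fin (n + 1) → Y) → ℝ} (hP : ∀ y, 0 < P y)
    (hP' : ∀ y, 0 < P' y) : 0 ≤ DcModel P P' := by
  simpa [DcPred, DcModel] using DcPred_nonneg hP (isPredictor_condProb hP')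

theorem regretN_le_DcPred [Nonempty Y] {Pφ Pθ : (Fin (n + 1) → Y) → ℝ}
    (hφ : ∀ y, 0 < Pφ y) (hθ : ∀ y, 0 < Pθ y)
    {Q : (Fin n → Y) → Y → ℝ} (hQ : IsPredictor Q) :
    regretN Pφ Pθ Q ≤ DcPred Pφ Q := by
  rw [regretN_eq_sub hφ hθ hQ]
  exact sub_le_self _ (DcModel_nonneg hφ hθ)

/-- The mixture `Σ_φ π(φ) P_φ` of a family of models. -/
def mixModel (P : F → (Fin (n + 1) → Y) → ℝ) (π : F → ℝ) (y : Fin (n + 1) → Y) : ℝ :=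
  ∑ φ, π φ * P φ y

theorem sum_mixModel_mul (P : F → (Fin (n + 1) → Y) → ℝ) (π : F → ℝ)
    (f : (Fin (n + 1) → Y) → ℝ) :
    ∑ y, mixModel P π y * f y = ∑ φ, π φ * ∑ y, P φ y * f y := by
  simp only [mixModel, Finset.sum_mul, Finset.mul_sum, mul_assoc]
  exact Finset.sum_comm

theorem IsPrior.sum_mul_pos {π : F → ℝ} (hπ : IsPrior π) {f : F → ℝ} (hf : ∀ φ, 0 < f φ) :
    0 < ∑ φ, π φ * f φ := by
  obtain ⟨φ, -, hφ⟩ := Finset.exists_ne_zero_of_sum_ne_zero (hπ.2.trans_ne one_ne_zero)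
  exact Finset.sum_pos' (fun ψ _ => mul_nonneg (hπ.1 ψ) (hf ψ).le)
    ⟨φ, Finset.mem_univ φ, mul_pos ((hπ.1 φ).lt_of_ne' hφ) (hf φ)⟩

theorem prefixProb_mixModel (P : F → (Fin (n + 1) → Y) → ℝ) (π : F → ℝ) (z : Fin n → Y) :
    prefixProb (mixModel P π) z = ∑ φ, π φ * prefixProb (P φ) z := by
  simp only [prefixProb, mixModel, Finset.mul_sum]
  exact Finset.sum_comm

theorem mixPred_eq_condProb (P : F → (Fin (n + 1) → Y) → ℝ) (π : F → ℝ) :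
    mixPred P π = fun z a => condProb (mixModel P π) (Fin.snoc z a) := by
  funext z a
  simp only [mixPred, condProb, Fin.init_snoc, prefixProb_mixModel, mixModel]

theorem isPredictor_mixPred [Nonempty Y] {P : F → (Fin (n + 1) → Y) → ℝ}
    (hP : ∀ φ y, 0 < P φ y) {π : F → ℝ} (hπ : IsPrior π) : IsPredictor (mixPred P π) := by
  rw [mixPred_eq_condProb]
  exact isPredictor_condProb fun y => hπ.sum_mul_pos fun φ => hP φ y

theorem mutualInfoN_eq_sum_DcPred (P : F → (Fin (n + 1) → Y) → ℝ) (π : F → ℝ) :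
    mutualInfoN P π = ∑ φ, π φ * DcPred (P φ) (mixPred P π) := by
  simp only [mutualInfoN, DcPred, Finset.mul_sum, mul_assoc]

/-- The compensation identity: the average divergence from a predictor exceeds the mutual
information by the divergence of the mixture from that predictor. -/
theorem sum_mul_DcPred_eq [Nonempty Y] {P : F → (Fin (n + 1) → Y) → ℝ}
    (hP : ∀ φ y, 0 < P φ y) {π : F → ℝ} (hπ : IsPrior π)
    {Q : (Fin n → Y) → Y → ℝ} (hQ : IsPredictor Q) :
    ∑ φ, π φ * DcPred (P φ) Q = mutualInfoN P π + DcPred (mixModel P π) Q := by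
  have hM : ∀ y, 0 < mixModel P π y := fun y => hπ.sum_mul_pos fun φ => hP φ y
  rw [mutualInfoN_eq_sum_DcPred, mixPred_eq_condProb]
  simp only [DcPred, Fin.snoc_init_self]
  rw [sum_mixModel_mul, ← Finset.sum_add_distrib]
  refine Finset.sum_congr rfl fun φ _ => ?_
  rw [← mul_add, ← Finset.sum_add_distrib]
  congr 1
  refine Finset.sum_congr rfl fun y _ => ?_
  have hq := (hQ (Fin.init y)).1 (y (Fin.last n))
  rw [Real.log_div (condProb_pos (hP φ) y).ne' hq.ne', Real.log_div (condProb_pos hM y).ne' hq.ne',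
    Real.log_div (condProb_pos (hP φ) y).ne' (condProb_pos hM y).ne']
  ring

theorem mutualInfoN_le_sum_mul_DcPred [Nonempty Y] {P : F → (Fin (n + 1) → Y) → ℝ}
    (hP : ∀ φ y, 0 < P φ y) {π : F → ℝ} (hπ : IsPrior π)
    {Q : (Fin n → Y) → Y → ℝ} (hQ : IsPredictor Q) :
    mutualInfoN P π ≤ ∑ φ, π φ * DcPred (P φ) Q := by
  rw [sum_mul_DcPred_eq hP hπ hQ]
  exact le_add_of_nonneg_right (DcPred_nonneg (fun y => hπ.sum_mul_pos fun φ => hP φ y) hQ)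

theorem continuousOn_DcPred_mixPred [Nonempty Y] {P : F → (Fin (n + 1) → Y) → ℝ}
    (hP : ∀ φ y, 0 < P φ y) (φ : F) :
    ContinuousOn (fun π => DcPred (P φ) (mixPred P π)) (stdSimplex ℝ F) := by
  unfold DcPred
  refine continuousOn_finsetSum _ fun y _ => continuousOn_const.mul (ContinuousOn.log ?_ ?_)
  · refine continuousOn_const.div ?_ fun π hπ =>
      ((isPredictor_mixPred hP hπ _).1 _).ne'
    refine ContinuousOn.div (by fun_prop) (by fun_prop) fun π hπ => ?_
    exact (IsPrior.sum_mul_pos hπ fun ψ => prefixProb_pos (hP ψ) _).ne'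
  · exact fun π hπ => (div_pos (condProb_pos (hP φ) y) ((isPredictor_mixPred hP hπ _).1 _)).ne'

theorem continuousOn_mutualInfoN [Nonempty Y] {P : F → (Fin (n + 1) → Y) → ℝ}
    (hP : ∀ φ y, 0 < P φ y) : ContinuousOn (mutualInfoN P) (stdSimplex ℝ F) := by
  rw [funext (mutualInfoN_eq_sum_DcPred P)]
  exact continuousOn_finsetSum _ fun φ _ =>
    (continuous_apply φ).continuousOn.mul (continuousOn_DcPred_mixPred hP φ)

/-- If `π` maximizes the mutual information, then no model of the family diverges from the
mixture predictor of `π` by more than that maximum. -/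
theorem DcPred_mixPred_le_of_isMaxOn [Nonempty Y] {P : F → (Fin (n + 1) → Y) → ℝ}
    (hP : ∀ φ y, 0 < P φ y) {π : F → ℝ} (hπ : π ∈ stdSimplex ℝ F)
    (hmax : IsMaxOn (mutualInfoN P) (stdSimplex ℝ F) π) (φ : F) :
    DcPred (P φ) (mixPred P π) ≤ mutualInfoN P π := by
  classical
  set p : ℝ → F → ℝ := fun t => (1 - t) • π + t • Pi.single φ 1 with hp
  have hp0 : p 0 = π := by simp [hp]
  have hmem : ∀ t ∈ Set.Ico (0 : ℝ) 1, p t ∈ stdSimplex ℝ F := fun t ht =>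
    convex_stdSimplex ℝ F hπ (single_mem_stdSimplex ℝ φ) (sub_nonneg.2 ht.2.le) ht.1 (by ring)
  have hbound : ∀ t ∈ Set.Ioo (0 : ℝ) 1, DcPred (P φ) (mixPred P (p t)) ≤ mutualInfoN P π := by
    intro t ht
    have hpt := hmem t (Set.Ioo_subset_Ico_self ht)
    have hI : mutualInfoN P (p t) ≤ mutualInfoN P π := hmax hpt
    have hle := mutualInfoN_le_sum_mul_DcPred hP hπ (isPredictor_mixPred hP hpt)
    have hsplit : mutualInfoN P (p t) = (1 - t) * ∑ ψ, π ψ * DcPred (P ψ) (mixPred P (p t))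
        + t * DcPred (P φ) (mixPred P (p t)) := by
      rw [mutualInfoN_eq_sum_DcPred]
      generalize mixPred P (p t) = Q
      simp [hp, add_mul, Finset.sum_add_distrib, Finset.mul_sum, mul_assoc, Pi.single_apply]
    have := mul_le_mul_of_nonneg_left hle (sub_nonneg.2 ht.2.le)
    exact le_of_mul_le_mul_left (by linarith) ht.1
  have hcont : ContinuousOn (fun t => DcPred (P φ) (mixPred P (p t))) (Set.Ico 0 1) :=
    (continuousOn_DcPred_mixPred hP φ).comp (by fun_prop) hmem
  have hlim := (hcont 0 ⟨le_rfl, one_pos⟩).mono Set.Ioo_subset_Ico_self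
  have := left_nhdsWithin_Ioo_neBot (one_pos (α := ℝ))
  simpa [hp0] using le_of_tendsto hlim (Filter.eventually_of_mem self_mem_nhdsWithin hbound)

theorem bddBelow_maxRegret [Nonempty Y] [Nonempty F] {P : F → (Fin (n + 1) → Y) → ℝ}
    (hP : ∀ φ y, 0 < P φ y) (G : Finset F) (hG : G.Nonempty) :
    BddBelow {r : ℝ | ∃ Q, IsPredictor Q ∧
      r = Finset.univ.sup' Finset.univ_nonempty fun φ =>
            G.sup' hG fun θ => regretN (P φ) (P θ) Q} := by
  refine ⟨0, ?_⟩
  rintro _ ⟨Q, hQ, rfl⟩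
  obtain ⟨θ, hθ⟩ := hG
  exact (DcPred_nonneg (hP θ) hQ).trans <|
    (Finset.le_sup' (fun θ' => regretN (P θ) (P θ') Q) hθ).trans <|
    Finset.le_sup' (fun φ => G.sup' ⟨θ, hθ⟩ fun θ' => regretN (P φ) (P θ') Q) (Finset.mem_univ θ)

end Mixture

variable {Y F : Type*} [Fintype Y] [Nonempty Y] [Fintype F] [Nonempty F] {n : ℕ}

/-- the min-max regret is bounded above by the conditional capacity
of the data-generating family. -/
theorem Rstar_le_capacity
    (P : F → (Fin (n + 1) → Y) → ℝ) (hP : ∀ φ, IsModel (P φ))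
    (G : Finset F) (hG : G.Nonempty) :
    Rstar P G hG ≤ capacityN P := by
  classical
  have hpos : ∀ φ y, 0 < P φ y := fun φ => (hP φ).1
  obtain ⟨π, hπ, hmax⟩ := (isCompact_stdSimplex ℝ F).exists_isMaxOn
    ⟨_, single_mem_stdSimplex ℝ (Classical.arbitrary F)⟩ (continuousOn_mutualInfoN hpos)
  have hQ := isPredictor_mixPred hpos hπ
  have hcap : mutualInfoN P π ≤ capacityN P := by
    refine le_csSup ⟨mutualInfoN P π, ?_⟩ ⟨π, hπ, rfl⟩
    rintro _ ⟨ρ, hρ, rfl⟩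
    exact hmax hρ
  refine (csInf_le (bddBelow_maxRegret hpos G hG) ⟨_, hQ, rfl⟩).trans (le_trans ?_ hcap)
  exact Finset.sup'_le _ _ fun φ _ => Finset.sup'_le _ _ fun θ _ =>
    (regretN_le_DcPred (hpos φ) (hpos θ) hQ).trans
      (DcPred_mixPred_le_of_isMaxOn hpos hπ hmax φ)
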